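/- There exists a partition of B = {x ∈ (ℤ/2ℤ)^10 : Hamming weight of x ≥ 7} into two sets B₁ and B₂ such that, with R = {x : 1 ≤ |x| ≤ 6} and G = (ℤ/2ℤ)^10: R + B₁ = R + B₂ = G \ {0}, B₁ + B₁ = B₂ + B₂ = R ∪ {0}, and B₁ + B₂ = R. -/

import Mathlib

/-- Hamming weight of a vector in (ℤ/2ℤ)^m. -/
def hwt {m : ℕ} (x : Fin m → ZMod 2) : ℕ :=
  (Finset.univ.filter (fun i => x i = 1)).card

/-- The vector in `(ℤ/2ℤ)^10` whose `i`-th coordinate is the `i`-th binary digit of `n`. -/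
def bitVector (n : ℕ) : Fin 10 → ZMod 2 := fun i => if n.testBit i then 1 else 0

/-- The number of ones among the ten lowest binary digits of `n`. -/
def bitWeight (n : ℕ) : ℕ :=
  n % 2 + n / 2 % 2 + n / 4 % 2 + n / 8 % 2 + n / 16 % 2 + n / 32 % 2 + n / 64 % 2 +
    n / 128 % 2 + n / 256 % 2 + n / 512 % 2

/-- The codes of the vectors in the first part of the partition. -/
def firstCodes : List ℕ :=
  [223, 247, 251, 255, 351, 367, 375, 382, 383, 415, 431, 439, 446, 447, 477, 487, 493, 494,
    495, 505, 506, 509, 510, 607, 635, 637, 638, 671, 687, 699, 702, 703, 731, 734, 749, 751,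
    758, 759, 761, 762, 763, 764, 767, 823, 829, 830, 855, 862, 871, 875, 879, 885, 886, 889,
    891, 892, 911, 923, 925, 939, 942, 949, 950, 955, 957, 967, 973, 974, 975, 981, 982, 983,
    985, 987, 990, 995, 1002, 1005, 1009, 1010, 1011, 1017, 1019, 1020, 1022, 1023]

/-- The codes of the vectors in the second part of the partition. -/
def secondCodes : List ℕ :=
  [127, 191, 239, 253, 254, 319, 379, 381, 443, 445, 463, 471, 475, 478, 479, 491, 499, 501,
    502, 503, 507, 508, 511, 575, 623, 631, 639, 695, 701, 719, 727, 733, 735, 743, 747, 750,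
    755, 757, 765, 766, 799, 815, 827, 831, 847, 859, 861, 863, 877, 878, 883, 887, 890, 893,
    894, 895, 919, 926, 927, 935, 941, 943, 947, 951, 953, 954, 956, 958, 959, 971, 979, 986,
    988, 989, 991, 997, 998, 999, 1001, 1003, 1004, 1006, 1007, 1012, 1013, 1014, 1015, 1016,
    1018, 1021]

/-- The set of vectors with codes in a given list. -/
def codedSet (l : List ℕ) : Set (Fin 10 → ZMod 2) := {x | ∃ n ∈ l, bitVector n = x}

theorem bitVector_xor (a b : ℕ) : bitVector (a ^^^ b) = bitVector a + bitVector b := by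
  funext i
  simp only [bitVector, Pi.add_apply, Nat.testBit_xor]
  cases a.testBit i <;> cases b.testBit i <;> decide

theorem hwt_bitVector (n : ℕ) : hwt (bitVector n) = bitWeight n := by
  have h (i : Fin 10) : (if bitVector n i = 1 then 1 else 0) = n / 2 ^ (i : ℕ) % 2 := by
    rw [← Nat.toNat_testBit, bitVector]
    cases n.testBit i <;> decide
  simp only [hwt, Finset.card_filter, h]
  rw [Fin.sum_univ_eq_sum_range (fun i => n / 2 ^ i % 2) 10]
  simp [bitWeight, Finset.sum_range_succ]

theorem exists_bitVector_eq (x : Fin 10 → ZMod 2) : ∃ n < 1024, bitVector n = x := by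
  refine ⟨Nat.ofBits fun i => decide (x i = 1), Nat.ofBits_lt_two_pow _, ?_⟩
  funext i
  simp only [bitVector, Nat.testBit_ofBits_lt _ _ i.isLt, decide_eq_true_eq, Fin.eta]
  generalize x i = y
  revert y
  decide

theorem hwt_eq_zero_iff (x : Fin 10 → ZMod 2) : hwt x = 0 ↔ x = 0 := by
  have h (y : ZMod 2) : ¬ y = 1 ↔ y = 0 := by revert y; decide
  simp [hwt, Finset.filter_eq_empty_iff, h, funext_iff]

theorem firstCodes_bounds : ∀ n ∈ firstCodes, n < 1024 ∧ 7 ≤ bitWeight n := by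
  decide +kernel

theorem secondCodes_bounds : ∀ n ∈ secondCodes, n < 1024 ∧ 7 ≤ bitWeight n := by
  decide +kernel

theorem disjoint_firstCodes_secondCodes : ∀ n ∈ secondCodes, n ∉ firstCodes := by
  decide +kernel

theorem mem_firstCodes_or_mem_secondCodes :
    ∀ n ∈ List.range 1024, 7 ≤ bitWeight n → n ∈ firstCodes ∨ n ∈ secondCodes := by
  decide +kernel

theorem bitVector_injOn {a b : ℕ} (ha : a < 1024) (hb : b < 1024)
    (h : bitVector a = bitVector b) : a = b := by
  have hx : bitVector (a ^^^ b) = 0 := by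
    rw [bitVector_xor, h]
    funext i
    exact CharTwo.add_self_eq_zero _
  refine Nat.eq_of_testBit_eq fun i => ?_
  by_cases hi : i < 10
  · have := congrFun hx ⟨i, hi⟩
    simp only [bitVector, Nat.testBit_xor, Pi.zero_apply] at this
    revert this
    cases a.testBit i <;> cases b.testBit i <;> decide
  · have hp : 1024 ≤ 2 ^ i := Nat.pow_le_pow_right (n := 2) (by norm_num) (not_lt.mp hi)
    rw [Nat.testBit_lt_two_pow (ha.trans_le hp), Nat.testBit_lt_two_pow (hb.trans_le hp)]

/-- Two vectors of weight at least `7` out of `10` differ in at most `6` coordinates. -/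
theorem hwt_add_le {x y : Fin 10 → ZMod 2} (hx : 7 ≤ hwt x) (hy : 7 ≤ hwt y) :
    hwt (x + y) ≤ 6 := by
  have key : hwt (x + y) + hwt x + hwt y ≤ 20 := by
    have h (a b : ZMod 2) : (if a + b = 1 then 1 else 0) + (if a = 1 then 1 else 0) +
        (if b = 1 then 1 else 0) ≤ 2 := by revert a b; decide
    simp only [hwt, Finset.card_filter, Pi.add_apply, ← Finset.sum_add_distrib]
    exact (Finset.sum_le_sum fun i _ => h (x i) (y i)).trans (by simp)
  omega

/-- The number whose binary digits equal to one are those at the positions in `l`. -/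
def codeMask (l : List ℕ) : ℕ := l.foldr (fun n m => 2 ^ n ||| m) 0

theorem testBit_codeMask (l : List ℕ) (i : ℕ) : (codeMask l).testBit i = true ↔ i ∈ l := by
  induction l with
  | nil => simp [codeMask]
  | cons n l ih =>
    rw [codeMask, List.foldr_cons, ← codeMask, Nat.testBit_or, Bool.or_eq_true, ih,
      Nat.testBit_two_pow, decide_eq_true_iff, List.mem_cons, eq_comm]

/-- Every code of weight between `1` and `6` is a sum of a code in `l` and a code in `m`. -/
def SumsCover (l m : List ℕ) : Prop :=
  ∀ z ∈ List.range 1024, 1 ≤ bitWeight z → bitWeight z ≤ 6 → ∃ a ∈ l, a ^^^ z ∈ m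

/-- A Boolean test for `SumsCover`, with membership in `m` read off its mask. -/
def sumsCoverTest (l m : List ℕ) : Bool :=
  (List.range 1024).all fun z =>
    !(Nat.ble 1 (bitWeight z)) || !(Nat.ble (bitWeight z) 6) ||
      l.any fun a => (codeMask m).testBit (a ^^^ z)

theorem sumsCover_of_test {l m : List ℕ} (h : sumsCoverTest l m = true) : SumsCover l m := by
  intro z hz h1 h6
  have := List.all_eq_true.mp h z hz
  rw [← Nat.ble_eq] at h1 h6
  simpa [h1, h6, testBit_codeMask] using this

/-- Every nonzero code differs from some code in `l` in between `1` and `6` digits. -/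
def ShiftsCover (l : List ℕ) : Prop :=
  ∀ z ∈ List.range 1024, z ≠ 0 → ∃ a ∈ l, 1 ≤ bitWeight (a ^^^ z) ∧ bitWeight (a ^^^ z) ≤ 6

/-- A Boolean test for `ShiftsCover`. -/
def shiftsCoverTest (l : List ℕ) : Bool :=
  (List.range 1024).all fun z =>
    Nat.beq z 0 || l.any fun a => Nat.ble 1 (bitWeight (a ^^^ z)) && Nat.ble (bitWeight (a ^^^ z)) 6

theorem shiftsCover_of_test {l : List ℕ} (h : shiftsCoverTest l = true) : ShiftsCover l := by
  intro z hz h0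
  have := List.all_eq_true.mp h z hz
  simpa [h0, Nat.ble_eq] using this

theorem sumsCover_first_first : SumsCover firstCodes firstCodes :=
  sumsCover_of_test (by decide +kernel)

theorem sumsCover_second_second : SumsCover secondCodes secondCodes :=
  sumsCover_of_test (by decide +kernel)

theorem sumsCover_first_second : SumsCover firstCodes secondCodes :=
  sumsCover_of_test (by decide +kernel)

theorem shiftsCover_first : ShiftsCover firstCodes :=
  shiftsCover_of_test (by decide +kernel)

theorem shiftsCover_second : ShiftsCover secondCodes :=
  shiftsCover_of_test (by decide +kernel)

theorem SumsCover.exists_add_eq {l m : List ℕ} (h : SumsCover l m) {z : Fin 10 → ZMod 2}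
    (h1 : 1 ≤ hwt z) (h6 : hwt z ≤ 6) : ∃ x ∈ codedSet l, ∃ y ∈ codedSet m, x + y = z := by
  obtain ⟨n, hn, rfl⟩ := exists_bitVector_eq z
  rw [hwt_bitVector] at h1 h6
  obtain ⟨a, ha, hb⟩ := h n (List.mem_range.mpr hn) h1 h6
  refine ⟨_, ⟨a, ha, rfl⟩, _, ⟨_, hb, rfl⟩, ?_⟩
  rw [← bitVector_xor, Nat.xor_xor_cancel_left]

theorem ShiftsCover.setOf_add_eq {l : List ℕ} (h : ShiftsCover l)
    (hl : ∀ x ∈ codedSet l, 7 ≤ hwt x) :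
    {z | ∃ x ∈ {x : Fin 10 → ZMod 2 | 1 ≤ hwt x ∧ hwt x ≤ 6}, ∃ y ∈ codedSet l, x + y = z} =
      Set.univ \ {0} := by
  ext z
  simp only [Set.mem_ofPred_eq, Set.mem_sdiff, Set.mem_univ, true_and, Set.mem_singleton_iff]
  constructor
  · rintro ⟨x, hx, y, hy, rfl⟩ h0
    have := hl y hy
    rw [← CharTwo.add_eq_zero.mp h0] at this
    omega
  · intro hz
    obtain ⟨n, hn, rfl⟩ := exists_bitVector_eq z
    obtain ⟨a, ha, hb⟩ := h n (List.mem_range.mpr hn) (by rintro rfl; exact hz (by decide))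
    refine ⟨bitVector (a ^^^ n), by rwa [hwt_bitVector], _, ⟨a, ha, rfl⟩, ?_⟩
    rw [← bitVector_xor, Nat.xor_comm a n, Nat.xor_xor_cancel_right]

theorem SumsCover.setOf_add_eq {l : List ℕ} (h : SumsCover l l) (hne : (codedSet l).Nonempty)
    (hl : ∀ x ∈ codedSet l, 7 ≤ hwt x) :
    {z | ∃ x ∈ codedSet l, ∃ y ∈ codedSet l, x + y = z} =
      {x : Fin 10 → ZMod 2 | 1 ≤ hwt x ∧ hwt x ≤ 6} ∪ {0} := by
  ext z
  simp only [Set.mem_ofPred_eq, Set.mem_union, Set.mem_singleton_iff]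
  constructor
  · rintro ⟨x, hx, y, hy, rfl⟩
    rw [← hwt_eq_zero_iff]
    have := hwt_add_le (hl x hx) (hl y hy)
    omega
  · rintro (⟨h1, h6⟩ | rfl)
    · exact h.exists_add_eq h1 h6
    · obtain ⟨x, hx⟩ := hne
      exact ⟨x, hx, x, hx, funext fun i => CharTwo.add_self_eq_zero (x i)⟩

theorem SumsCover.setOf_add_eq_of_disjoint {l m : List ℕ} (h : SumsCover l m)
    (hl : ∀ x ∈ codedSet l, 7 ≤ hwt x) (hm : ∀ x ∈ codedSet m, 7 ≤ hwt x)
    (hlm : codedSet l ∩ codedSet m = ∅) :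
    {z | ∃ x ∈ codedSet l, ∃ y ∈ codedSet m, x + y = z} =
      {x : Fin 10 → ZMod 2 | 1 ≤ hwt x ∧ hwt x ≤ 6} := by
  ext z
  simp only [Set.mem_ofPred_eq]
  constructor
  · rintro ⟨x, hx, y, hy, rfl⟩
    refine ⟨Nat.one_le_iff_ne_zero.mpr fun h0 => ?_, hwt_add_le (hl x hx) (hm y hy)⟩
    have hxy : x = y := CharTwo.add_eq_zero.mp ((hwt_eq_zero_iff _).mp h0)
    exact Set.notMem_empty x (hlm ▸ ⟨hx, hxy ▸ hy⟩)
  · rintro ⟨h1, h6⟩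
    exact h.exists_add_eq h1 h6

theorem stmt_19 (R B : Set (Fin 10 → ZMod 2))
    (hR : R = {x | 1 ≤ hwt x ∧ hwt x ≤ 6})
    (hB : B = {x | 7 ≤ hwt x}) :
    ∃ B₁ B₂ : Set (Fin 10 → ZMod 2),
      B₁ ∪ B₂ = B ∧ B₁ ∩ B₂ = ∅ ∧
      {z | ∃ x ∈ R, ∃ y ∈ B₁, x + y = z} = Set.univ \ {0} ∧
      {z | ∃ x ∈ R, ∃ y ∈ B₂, x + y = z} = Set.univ \ {0} ∧
      {z | ∃ x ∈ B₁, ∃ y ∈ B₁, x + y = z} = R ∪ {0} ∧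
      {z | ∃ x ∈ B₂, ∃ y ∈ B₂, x + y = z} = R ∪ {0} ∧
      {z | ∃ x ∈ B₁, ∃ y ∈ B₂, x + y = z} = R := by
  subst hR hB
  have hfirst : ∀ x ∈ codedSet firstCodes, 7 ≤ hwt x := by
    rintro _ ⟨n, hn, rfl⟩
    rw [hwt_bitVector]
    exact (firstCodes_bounds n hn).2
  have hsecond : ∀ x ∈ codedSet secondCodes, 7 ≤ hwt x := by
    rintro _ ⟨n, hn, rfl⟩
    rw [hwt_bitVector]
    exact (secondCodes_bounds n hn).2
  have hdisj : codedSet firstCodes ∩ codedSet secondCodes = ∅ := by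
    rw [Set.eq_empty_iff_forall_notMem]
    rintro _ ⟨⟨a, ha, rfl⟩, b, hb, hab⟩
    have hba := bitVector_injOn (secondCodes_bounds b hb).1 (firstCodes_bounds a ha).1 hab
    exact disjoint_firstCodes_secondCodes b hb (hba ▸ ha)
  refine ⟨codedSet firstCodes, codedSet secondCodes, ?_, hdisj,
    shiftsCover_first.setOf_add_eq hfirst, shiftsCover_second.setOf_add_eq hsecond,
    sumsCover_first_first.setOf_add_eq ⟨_, 223, by decide, rfl⟩ hfirst,
    sumsCover_second_second.setOf_add_eq ⟨_, 127, by decide, rfl⟩ hsecond,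
    sumsCover_first_second.setOf_add_eq_of_disjoint hfirst hsecond hdisj⟩
  refine Set.Subset.antisymm (Set.union_subset hfirst hsecond) fun x hx => ?_
  obtain ⟨n, hn, rfl⟩ := exists_bitVector_eq x
  rw [Set.mem_ofPred_eq, hwt_bitVector] at hx
  exact (mem_firstCodes_or_mem_secondCodes n (List.mem_range.mpr hn) hx).imp
    (fun h => ⟨n, h, rfl⟩) fun h => ⟨n, h, rfl⟩
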